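/- (Lemma 1, achievability, reduced to packet counts.) Let λ > 0, let 0 < ε < 1, and suppose T > 8ε²/λ, so that Δ := ε·√(2λ/T) satisfies Δ < λ/2. Let P₀ be the Poisson distribution with mean λT (the packet count when Alice is not buffering) and P₁ the Poisson distribution with mean (λ − Δ)T (the packet count when Alice slows the outgoing packet stream to rate λ − Δ). Then for every subset A ⊆ ℕ, P₀(A) + P₁(ℕ \ A) ≥ 1 − ε; that is, every detector based on the packet count has sum of false alarm and missed detection probabilities at least 1 − ε. -/

import Mathlib

/-- The Poisson probability mass function with mean `m`: `P(n) = e^{-m} mⁿ / n!`. -/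
noncomputable def poissonPMF (m : ℝ) (n : ℕ) : ℝ :=
  Real.exp (-m) * m ^ n / n.factorial

/-- The probability assigned by a pmf `P` on ℕ to a set `A ⊆ ℕ`. -/
noncomputable def pmfProb (P : ℕ → ℝ) (A : Set ℕ) : ℝ :=
  ∑' n : ℕ, A.indicator P n

theorem hasSum_const_mul_pow_div_factorial (c m : ℝ) :
    HasSum (fun n : ℕ => c * m ^ n / n.factorial) (c * Real.exp m) := by
  have h := (NormedSpace.expSeries_div_hasSum_exp (𝔸 := ℝ) m).mul_left c
  rw [← Real.exp_eq_exp_ℝ] at h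
  simpa only [mul_div_assoc] using h

theorem hasSum_poissonPMF (m : ℝ) : HasSum (poissonPMF m) 1 := by
  have h := hasSum_const_mul_pow_div_factorial (Real.exp (-m)) m
  rwa [← Real.exp_add, neg_add_cancel, Real.exp_zero] at h

theorem poissonPMF_nonneg {m : ℝ} (hm : 0 ≤ m) (n : ℕ) : 0 ≤ poissonPMF m n := by
  unfold poissonPMF
  positivity

theorem hasSum_pmfProb {P : ℕ → ℝ} (hP : Summable P) (A : Set ℕ) :
    HasSum (A.indicator P) (pmfProb P A) :=
  (hP.indicator A).hasSum

theorem pmfProb_add_compl {P : ℕ → ℝ} {s : ℝ} (hP : HasSum P s) (A : Set ℕ) :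
    pmfProb P A + pmfProb P Aᶜ = s := by
  refine ((hasSum_pmfProb hP.summable A).add (hasSum_pmfProb hP.summable Aᶜ)).unique ?_
  rw [← Pi.add_def, Set.indicator_self_add_compl]
  exact hP

/-- The sum `S` of the two error probabilities of a test between `P` and `Q` is related to their
Bhattacharyya coefficient `B` by `B² ≤ S (2 - S) = 1 - (1 - S)²`. -/
theorem sq_le_one_sub_sq_of_hasSum {P Q w : ℕ → ℝ} {B : ℝ}
    (hP : HasSum P 1) (hQ : HasSum Q 1) (hw : HasSum w B)
    (hP0 : ∀ n, 0 ≤ P n) (hQ0 : ∀ n, 0 ≤ Q n) (hwPQ : ∀ n, w n ^ 2 = P n * Q n)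
    (hB : 0 < B) (A : Set ℕ) (hS : pmfProb P A + pmfProb Q Aᶜ < 1) :
    B ^ 2 ≤ 1 - (1 - (pmfProb P A + pmfProb Q Aᶜ)) ^ 2 := by
  set S := pmfProb P A + pmfProb Q Aᶜ
  have hu : HasSum (fun n => A.indicator P n + Aᶜ.indicator Q n) S :=
    (hasSum_pmfProb hP.summable A).add (hasSum_pmfProb hQ.summable Aᶜ)
  have hv : HasSum (fun n => A.indicator Q n + Aᶜ.indicator P n) (2 - S) := by
    have h := (hasSum_pmfProb hQ.summable A).add (hasSum_pmfProb hP.summable Aᶜ)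
    have h2 : 2 - S = pmfProb Q A + pmfProb P Aᶜ := by
      linarith [pmfProb_add_compl hP A, pmfProb_add_compl hQ A]
    rwa [h2]
  have amgm (t : ℝ) : 2 * t * B ≤ t ^ 2 * S + (2 - S) := by
    refine hasSum_le (fun n => ?_) (hw.mul_left (2 * t)) ((hu.mul_left (t ^ 2)).add hv)
    have key (x y : ℝ) (hx : 0 ≤ x) (hy : 0 ≤ y) (h : w n ^ 2 = x * y) :
        2 * t * w n ≤ t ^ 2 * x + y := by
      refine le_of_sq_le_sq ?_ (by positivity)
      nlinarith [sq_nonneg (t ^ 2 * x - y)]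
    by_cases hn : n ∈ A
    · simpa [hn] using key _ _ (hP0 n) (hQ0 n) (hwPQ n)
    · simpa [hn] using key _ _ (hQ0 n) (hP0 n) ((hwPQ n).trans (mul_comm _ _))
  have h := amgm ((2 - S) / B)
  have h1 : 2 * ((2 - S) / B) * B = 2 * (2 - S) := by field_simp
  have h2 : ((2 - S) / B) ^ 2 * S = (2 - S) * ((2 - S) * S / B ^ 2) := by field_simp
  have h3 : 1 ≤ (2 - S) * S / B ^ 2 := by
    rw [h1, h2] at h
    nlinarith
  rw [le_div_iff₀ (by positivity)] at h3
  linarith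

/-- Two Poisson distributions with means `a` and `b` satisfying `a / 4 ≤ b` and
`(a - b)² ≤ 2 ε² a` cannot be tested with sum of error probabilities below `1 - ε`. -/
theorem one_sub_le_pmfProb_poissonPMF_add {a b ε : ℝ} (ha : 0 < a) (hab : a / 4 ≤ b)
    (hε : 0 ≤ ε) (hd : (a - b) ^ 2 ≤ 2 * ε ^ 2 * a) (A : Set ℕ) :
    1 - ε ≤ pmfProb (poissonPMF a) A + pmfProb (poissonPMF b) Aᶜ := by
  have hb : 0 < b := by linarith
  by_contra! hlt
  set c := Real.sqrt (a * b)
  have hc : c ^ 2 = a * b := Real.sq_sqrt (by positivity)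
  have hca : a / 2 ≤ c := Real.le_sqrt_of_sq_le (by nlinarith)
  have hw := hasSum_const_mul_pow_div_factorial (Real.exp (-((a + b) / 2))) c
  rw [← Real.exp_add] at hw
  have hB := sq_le_one_sub_sq_of_hasSum (hasSum_poissonPMF a) (hasSum_poissonPMF b) hw
    (poissonPMF_nonneg ha.le) (poissonPMF_nonneg hb.le) (fun n => ?_) (Real.exp_pos _) A
    (by linarith)
  · rw [← Real.exp_nat_mul] at hB
    have hexp := Real.add_one_le_exp (((2 : ℕ) : ℝ) * (-((a + b) / 2) + c))
    push_cast at hB hexp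
    have hgap : a + b - 2 * c ≤ ε ^ 2 := by
      by_contra! h
      nlinarith [mul_pos (sub_pos.2 h) (show 0 < a + b + 2 * c by linarith),
        mul_nonneg (sq_nonneg ε) (show 0 ≤ b + 2 * c - a by linarith)]
    nlinarith
  · have he : Real.exp (-((a + b) / 2)) ^ 2 = Real.exp (-a) * Real.exp (-b) := by
      rw [← Real.exp_nat_mul, ← Real.exp_add]
      congr 1
      push_cast
      ring
    unfold poissonPMF
    rw [div_pow, mul_pow, he, ← pow_mul, mul_comm n 2, pow_mul, hc, mul_pow]
    ring

/-- Lemma 1 (achievability), reduced to packet counts: for `λ > 0`, `0 < ε < 1`,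
`T > 8ε²/λ` and `Δ = ε √(2λ/T)` (so that `Δ < λ/2`), every detector with rejection
region `A ⊆ ℕ` for testing `P₀ =` Poisson(λT) against `P₁ =` Poisson((λ−Δ)T) has
sum of false alarm and missed detection probabilities at least `1 − ε`. -/
theorem covert_buffering_achievability (lam ε T Δ : ℝ) (hlam : 0 < lam)
    (hε0 : 0 < ε) (hε1 : ε < 1) (hT : T > 8 * ε ^ 2 / lam)
    (hΔ : Δ = ε * Real.sqrt (2 * lam / T)) (A : Set ℕ) :
    Δ < lam / 2 ∧
    pmfProb (poissonPMF (lam * T)) A + pmfProb (poissonPMF ((lam - Δ) * T)) Aᶜ ≥ 1 - ε := by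
  have hT0 : 0 < T := lt_of_le_of_lt (by positivity) hT
  have hΔ0 : 0 ≤ Δ := by
    rw [hΔ]
    positivity
  have hΔsq : Δ ^ 2 * T = 2 * ε ^ 2 * lam := by
    rw [hΔ, mul_pow, Real.sq_sqrt (by positivity)]
    field_simp
  have hTlam : 8 * ε ^ 2 < T * lam := (div_lt_iff₀ hlam).1 hT
  have hlt : Δ < lam / 2 := by
    refine lt_of_pow_lt_pow_left₀ 2 (by positivity) (lt_of_mul_lt_mul_right ?_ hT0.le)
    nlinarith
  refine ⟨hlt, one_sub_le_pmfProb_poissonPMF_add (by positivity) ?_ hε0.le ?_ A⟩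
  · nlinarith
  · have h : (lam * T - (lam - Δ) * T) ^ 2 = (Δ ^ 2 * T) * T := by ring
    rw [h, hΔsq]
    linarith
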